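/- arXiv:2201.01875 — 2 statements merged into one kernel-verified Lean document; each statement's English description precedes it below -/
import Mathlib

section
/- Fix an integer n ≥ 1 and define the R-linear map g : E_n^∨ → D_n^∨ ⊗_R B_n^∨ by: g(w^∨_k) = w^∨_k⊗v^∨ for all odd k; g(z^∨_ℓ) = z^∨_ℓ⊗v^∨ for all even ℓ; g(r^∨₀) = z^∨₀⊗r^∨₀ + w^∨₋₁⊗r^∨₁ + w^∨₁⊗r^∨₋₁; g(r^∨₋₁) = w^∨₋₁⊗t^∨ + z^∨₀⊗r^∨₋₁; g(r^∨₁) = w^∨₁⊗t^∨ + z^∨₀⊗r^∨₁; g(t^∨) = z^∨₀⊗t^∨. Then g is a grading-preserving chain map, it satisfies g∘τ_E^∨ = (τ_D^∨⊗τ_B^∨)∘g, and it induces an isomorphism on homology after tensoring over R with F₂[U^{±1}, V^{±1}]. -/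
open Finsupp

/-- The field with two elements. -/
abbrev F2 : Type := ZMod 2

/-- The ring `R = F₂[U,V]`: `U = X 0`, `V = X 1`. -/
abbrev R2 : Type := MvPolynomial (Fin 2) F2

noncomputable def UU : R2 := MvPolynomial.X 0
noncomputable def VV : R2 := MvPolynomial.X 1

/-- The involution of `R = F₂[U,V]` exchanging `U` and `V`. -/
noncomputable def swUV : R2 →+* R2 :=
  (MvPolynomial.rename (Equiv.swap (0 : Fin 2) 1)).toRingHom

/-- The skew-equivariant (semilinear over `swUV`) extension of a map given on basis
elements. -/
noncomputable def skewExt {β γ : Type} (f : β → (γ →₀ R2)) :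
    (β →₀ R2) → (γ →₀ R2) :=
  fun ξ => Finsupp.linearCombination R2 f (ξ.mapRange (swUV ·) (map_zero _))

/-- The element `f ⊗ g` in the concrete realization `β × γ →₀ R` of the tensor product
of free `R`-modules. -/
noncomputable def tp {β γ : Type} (f : β →₀ R2) (g : γ →₀ R2) : (β × γ) →₀ R2 :=
  f.sum fun a c => g.sum fun b c' => Finsupp.single (a, b) (c * c')

/-- Homogeneity of bidegree `deg` in a free bigraded `R`-module. -/
def Homog {β : Type} (g : β → ℤ × ℤ) (deg : ℤ × ℤ) (ξ : β →₀ R2) : Prop :=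
  ∀ b ∈ ξ.support, ∀ m ∈ (ξ b).support,
    (g b).1 - 2 * (m 0 : ℤ) = deg.1 ∧ (g b).2 - 2 * (m 1 : ℤ) = deg.2

/-! ### The dual `D_n^∨` of the staircase complex `D_n`

`D_n` has basis `{w_k}`, `{z_ℓ}` with `∂w_k = V^{⌈(k+4n−1)/4⌉} z_{k−1} +
U^{⌈(4n−1−k)/4⌉} z_{k+1}`, `∂z_ℓ = 0`.  Its dual (on the dual basis, with the
transpose differential) is `∂w^∨_k = 0`,
`∂z^∨_ℓ = U^{⌈(4n−ℓ)/4⌉} w^∨_{ℓ−1} + V^{⌈(ℓ+4n)/4⌉} w^∨_{ℓ+1}`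
(out-of-range dual basis elements being `0`); recall `⌈m/4⌉ = ⌊(m+3)/4⌋`. -/

abbrev WIdx (n : ℤ) := {k : ℤ // k % 2 = 1 ∧ -(4*n - 3) ≤ k ∧ k ≤ 4*n - 3}
abbrev ZIdx (n : ℤ) := {l : ℤ // l % 2 = 0 ∧ -(4*n - 2) ≤ l ∧ l ≤ 4*n - 2}
abbrev DBs (n : ℤ) := WIdx n ⊕ ZIdx n

/-- The underlying module of `D_n^∨`, on the dual basis `{w^∨_k, z^∨_ℓ}`. -/
abbrev Dd (n : ℤ) := DBs n →₀ R2

noncomputable def wDd (n k : ℤ) : Dd n :=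
  if h : k % 2 = 1 ∧ -(4*n - 3) ≤ k ∧ k ≤ 4*n - 3 then single (.inl ⟨k, h⟩) 1 else 0
noncomputable def zDd (n l : ℤ) : Dd n :=
  if h : l % 2 = 0 ∧ -(4*n - 2) ≤ l ∧ l ≤ 4*n - 2 then single (.inr ⟨l, h⟩) 1 else 0

/-- The transpose differential of `D_n^∨`. -/
noncomputable def dDd (n : ℤ) : Dd n →ₗ[R2] Dd n :=
  linearCombination R2 fun b => match b with
  | .inl _ => 0
  | .inr ⟨l, _⟩ =>
      UU ^ (((4*n + 3 - l)/4).toNat) • wDd n (l - 1) +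
        VV ^ (((l + 4*n + 3)/4).toNat) • wDd n (l + 1)

/-- Basis values of the transpose `τ_D^∨` of the reflection involution of `D_n`:
`w^∨_k ↦ w^∨_{−k}`, `z^∨_ℓ ↦ z^∨_{−ℓ}`. -/
noncomputable def τDdb (n : ℤ) : DBs n → Dd n := fun b => match b with
  | .inl ⟨k, _⟩ => wDd n (-k)
  | .inr ⟨l, _⟩ => zDd n (-l)

/-! ### The dual `E_n^∨` of `E_n = D_n ⊕ S_n` -/

/-- Basis of the square part: `r₀, r₋₁, r₁, t` (their duals for `E_n^∨`). -/
inductive SB : Type | r0 : SB | rm : SB | rp : SB | t : SB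

abbrev EB (n : ℤ) := DBs n ⊕ SB

/-- The underlying module of `E_n^∨`, on the dual basis. -/
abbrev Ed (n : ℤ) := EB n →₀ R2

noncomputable def wEd (n k : ℤ) : Ed n :=
  if h : k % 2 = 1 ∧ -(4*n - 3) ≤ k ∧ k ≤ 4*n - 3 then single (.inl (.inl ⟨k, h⟩)) 1 else 0
noncomputable def zEd (n l : ℤ) : Ed n :=
  if h : l % 2 = 0 ∧ -(4*n - 2) ≤ l ∧ l ≤ 4*n - 2 then single (.inl (.inr ⟨l, h⟩)) 1 else 0
noncomputable def sEd (n : ℤ) (s : SB) : Ed n := single (.inr s) 1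

/-- The transpose differential of `E_n^∨ = D_n^∨ ⊕ S_n^∨`:  on `D_n^∨` as above, and
`∂r^∨₋₁ = Vⁿ r^∨₀`, `∂r^∨₁ = Uⁿ r^∨₀`, `∂t^∨ = Uⁿ r^∨₋₁ + Vⁿ r^∨₁`, `∂r^∨₀ = 0`. -/
noncomputable def dEd (n : ℤ) : Ed n →ₗ[R2] Ed n :=
  linearCombination R2 fun b => match b with
  | .inl (.inl _) => 0
  | .inl (.inr ⟨l, _⟩) =>
      UU ^ (((4*n + 3 - l)/4).toNat) • wEd n (l - 1) +
        VV ^ (((l + 4*n + 3)/4).toNat) • wEd n (l + 1)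
  | .inr SB.r0 => 0
  | .inr SB.rm => VV ^ n.toNat • sEd n SB.r0
  | .inr SB.rp => UU ^ n.toNat • sEd n SB.r0
  | .inr SB.t => UU ^ n.toNat • sEd n SB.rm + VV ^ n.toNat • sEd n SB.rp

/-- The transpose `τ_E^∨` of the involution `τ_E` of `E_n`:
`w^∨_k ↦ w^∨_{−k}`, `z^∨_ℓ ↦ z^∨_{−ℓ}` (`ℓ ≠ 0`), `z^∨₀ ↦ z^∨₀`, `t^∨ ↦ t^∨ + z^∨₀`,
`r^∨₀ ↦ r^∨₀`, `r^∨₋₁ ↦ r^∨₁ + w^∨₁`, `r^∨₁ ↦ r^∨₋₁ + w^∨₋₁` (skew-equivariant). -/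
noncomputable def τEd (n : ℤ) : Ed n → Ed n :=
  skewExt fun b => match b with
  | .inl (.inl ⟨k, _⟩) => wEd n (-k)
  | .inl (.inr ⟨l, _⟩) => zEd n (-l)
  | .inr SB.r0 => sEd n SB.r0
  | .inr SB.rm => sEd n SB.rp + wEd n 1
  | .inr SB.rp => sEd n SB.rm + wEd n (-1)
  | .inr SB.t => sEd n SB.t + zEd n 0

/-! ### The dual `B_n^∨` of the box complex `B_n` -/

/-- Basis of the box complex `B_n` (their duals for `B_n^∨`): `v, r₀, r₋₁, r₁, t`. -/
inductive BB : Type | v : BB | r0 : BB | rm : BB | rp : BB | t : BB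

abbrev Bd : Type := BB →₀ R2

noncomputable def bBd (b : BB) : Bd := single b 1

/-- The transpose differential of `B_n^∨`: `∂v^∨ = 0`, `∂r^∨₀ = 0`,
`∂r^∨₋₁ = Vⁿ r^∨₀`, `∂r^∨₁ = Uⁿ r^∨₀`, `∂t^∨ = Uⁿ r^∨₋₁ + Vⁿ r^∨₁`. -/
noncomputable def dBd (n : ℤ) : Bd →ₗ[R2] Bd :=
  linearCombination R2 fun b => match b with
  | BB.v => 0
  | BB.r0 => 0
  | BB.rm => VV ^ n.toNat • bBd BB.r0
  | BB.rp => UU ^ n.toNat • bBd BB.r0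
  | BB.t => UU ^ n.toNat • bBd BB.rm + VV ^ n.toNat • bBd BB.rp

/-- Basis values of the transpose `τ_B^∨` of the involution `τ_B` of `B_n`:
`v^∨ ↦ v^∨`, `t^∨ ↦ v^∨ + t^∨`, `r^∨₀ ↦ r^∨₀`, `r^∨₋₁ ↦ r^∨₁`, `r^∨₁ ↦ r^∨₋₁`. -/
noncomputable def τBdb : BB → Bd := fun b => match b with
  | BB.v => bBd BB.v
  | BB.r0 => bBd BB.r0
  | BB.rm => bBd BB.rp
  | BB.rp => bBd BB.rm
  | BB.t => bBd BB.v + bBd BB.t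

/-! ### The tensor product `D_n^∨ ⊗_R B_n^∨` -/

abbrev DBd (n : ℤ) := (DBs n × BB) →₀ R2

/-- The differential `∂ ⊗ id + id ⊗ ∂` of `D_n^∨ ⊗_R B_n^∨`. -/
noncomputable def dDBd (n : ℤ) : DBd n →ₗ[R2] DBd n :=
  linearCombination R2 fun p =>
    tp (dDd n (single p.1 1)) (single p.2 1) + tp (single p.1 1) (dBd n (single p.2 1))

/-- The skew-equivariant map `τ_D^∨ ⊗ τ_B^∨` on `D_n^∨ ⊗_R B_n^∨`. -/
noncomputable def ττDBd (n : ℤ) : DBd n → DBd n :=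
  skewExt fun p => tp (τDdb n p.1) (τBdb p.2)

/-! ### Bigradings (the dual bigrading is the negative of the original one) -/

def IsDGrading (n : ℤ) (gw gz : ℤ → ℤ × ℤ) : Prop :=
  (gz (-(4*n) + 2)).2 = 0 ∧ (gz (4*n - 2)).1 = 0 ∧
  ∀ k : ℤ, k % 2 = 1 → -(4*n - 3) ≤ k → k ≤ 4*n - 3 →
    gz (k - 1) = ((gw k).1 - 1, (gw k).2 - 1 + 2*((k + 4*n + 2)/4)) ∧
    gz (k + 1) = ((gw k).1 - 1 + 2*((4*n + 2 - k)/4), (gw k).2 - 1)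

def IsSGrading (n : ℤ) (gz : ℤ → ℤ × ℤ) (gS : SB → ℤ × ℤ) : Prop :=
  gS SB.t = gz 0 ∧
  (gS SB.rm).1 - 1 = (gS SB.t).1 - 2*n ∧ (gS SB.rm).2 - 1 = (gS SB.t).2 ∧
  (gS SB.rp).1 - 1 = (gS SB.t).1 ∧ (gS SB.rp).2 - 1 = (gS SB.t).2 - 2*n ∧
  (gS SB.r0).1 - 1 = (gS SB.rm).1 ∧ (gS SB.r0).2 - 1 = (gS SB.rm).2 - 2*n ∧
  (gS SB.r0).1 - 1 = (gS SB.rp).1 - 2*n ∧ (gS SB.r0).2 - 1 = (gS SB.rp).2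

def IsBGrading (n : ℤ) (gB : BB → ℤ × ℤ) : Prop :=
  gB BB.v = (0, 0) ∧ gB BB.t = (0, 0) ∧
  (gB BB.rm).1 - 1 = (gB BB.t).1 - 2*n ∧ (gB BB.rm).2 - 1 = (gB BB.t).2 ∧
  (gB BB.rp).1 - 1 = (gB BB.t).1 ∧ (gB BB.rp).2 - 1 = (gB BB.t).2 - 2*n ∧
  (gB BB.r0).1 - 1 = (gB BB.rm).1 ∧ (gB BB.r0).2 - 1 = (gB BB.rm).2 - 2*n ∧
  (gB BB.r0).1 - 1 = (gB BB.rp).1 - 2*n ∧ (gB BB.r0).2 - 1 = (gB BB.rp).2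

def grD (gw gz : ℤ → ℤ × ℤ) {n : ℤ} : DBs n → ℤ × ℤ := fun b => match b with
  | .inl ⟨k, _⟩ => gw k
  | .inr ⟨l, _⟩ => gz l

def grE (gw gz : ℤ → ℤ × ℤ) (gS : SB → ℤ × ℤ) {n : ℤ} : EB n → ℤ × ℤ := fun b =>
  match b with
  | .inl (.inl ⟨k, _⟩) => gw k
  | .inl (.inr ⟨l, _⟩) => gz l
  | .inr s => gS s

/-- The bigrading of the basis of `D_n^∨ ⊗_R B_n^∨` (dual gradings are negated). -/
def grDBd (gw gz : ℤ → ℤ × ℤ) (gB : BB → ℤ × ℤ) {n : ℤ} : DBs n × BB → ℤ × ℤ :=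
  fun p => -(grD gw gz p.1) + -(gB p.2)

/-- The map `g : E_n^∨ → D_n^∨ ⊗_R B_n^∨` of Statement 12. -/
noncomputable def gEDBd (n : ℤ) : Ed n →ₗ[R2] DBd n :=
  linearCombination R2 fun b => match b with
  | .inl (.inl ⟨k, _⟩) => tp (wDd n k) (bBd BB.v)
  | .inl (.inr ⟨l, _⟩) => tp (zDd n l) (bBd BB.v)
  | .inr SB.r0 =>
      tp (zDd n 0) (bBd BB.r0) + tp (wDd n (-1)) (bBd BB.rp) + tp (wDd n 1) (bBd BB.rm)
  | .inr SB.rm => tp (wDd n (-1)) (bBd BB.t) + tp (zDd n 0) (bBd BB.rm)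
  | .inr SB.rp => tp (wDd n 1) (bBd BB.t) + tp (zDd n 0) (bBd BB.rp)
  | .inr SB.t => tp (zDd n 0) (bBd BB.t)

/-! ### Bilinearity of `tp` -/

section tp

variable {β γ : Type}

@[simp] theorem tp_single (a : β) (b : γ) (c c' : R2) :
    tp (single a c) (single b c') = single (a, b) (c * c') := by
  simp [tp]

@[simp] theorem tp_zero_left (g : γ →₀ R2) : tp (0 : β →₀ R2) g = 0 := by
  simp [tp]

@[simp] theorem tp_zero_right (f : β →₀ R2) : tp f (0 : γ →₀ R2) = 0 := by
  simp [tp]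

theorem tp_add_left (f f' : β →₀ R2) (g : γ →₀ R2) : tp (f + f') g = tp f g + tp f' g := by
  classical
  refine Finsupp.sum_add_index' (fun a => ?_) fun a c c' => ?_
  · simp
  · simp [add_mul, Finsupp.sum_add]

theorem tp_add_right (f : β →₀ R2) (g g' : γ →₀ R2) : tp f (g + g') = tp f g + tp f g' := by
  classical
  simp only [tp, ← Finsupp.sum_add]
  refine Finsupp.sum_congr fun a _ => Finsupp.sum_add_index' (fun b => ?_) fun b c c' => ?_
  · simp
  · simp [mul_add]

theorem tp_smul_left (r : R2) (f : β →₀ R2) (g : γ →₀ R2) : tp (r • f) g = r • tp f g := by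
  induction f using Finsupp.induction_linear with
  | zero => simp
  | add f f' hf hf' => simp only [smul_add, tp_add_left, hf, hf']
  | single a c =>
    induction g using Finsupp.induction_linear with
    | zero => simp
    | add g g' hg hg' => simp only [smul_add, tp_add_right, hg, hg']
    | single b c' =>
      simp only [Finsupp.smul_single, tp_single, smul_eq_mul, mul_assoc]

theorem tp_smul_right (r : R2) (f : β →₀ R2) (g : γ →₀ R2) : tp f (r • g) = r • tp f g := by
  induction f using Finsupp.induction_linear with
  | zero => simp
  | add f f' hf hf' => simp only [smul_add, tp_add_left, hf, hf']
  | single a c =>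
    induction g using Finsupp.induction_linear with
    | zero => simp
    | add g g' hg hg' => simp only [smul_add, tp_add_right, hg, hg']
    | single b c' =>
      simp only [Finsupp.smul_single, tp_single, smul_eq_mul, mul_left_comm]

end tp

theorem add_self_finsupp {β : Type} (x : β →₀ R2) : x + x = 0 := by
  ext1 b
  exact CharTwo.add_self_eq_zero (x b)

/-! ### Skew-equivariant extensions -/

section skewExt

variable {β γ : Type} (f : β → (γ →₀ R2))

theorem skewExt_add (x y : β →₀ R2) : skewExt f (x + y) = skewExt f x + skewExt f y := by
  simp only [skewExt]
  rw [Finsupp.mapRange_add (map_add swUV), map_add]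

@[simp] theorem skewExt_zero : skewExt f 0 = 0 := by
  simp [skewExt]

theorem skewExt_smul (r : R2) (x : β →₀ R2) : skewExt f (r • x) = swUV r • skewExt f x := by
  simp only [skewExt]
  rw [Finsupp.mapRange_smul' r (swUV r) x (fun y => map_mul swUV r y), map_smul]

@[simp] theorem skewExt_single (b : β) : skewExt f (single b 1) = f b := by
  simp [skewExt]

end skewExt

/-! ### The inclusion of `D_n^∨` and the differentials -/

/-- The inclusion `D_n^∨ → E_n^∨`. -/
noncomputable def inclD (n : ℤ) : Dd n →ₗ[R2] Ed n :=
  Finsupp.lmapDomain R2 R2 Sum.inl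

@[simp] theorem inclD_wDd (n k : ℤ) : inclD n (wDd n k) = wEd n k := by
  simp only [wDd, wEd]
  split_ifs <;> simp [inclD]

@[simp] theorem inclD_zDd (n l : ℤ) : inclD n (zDd n l) = zEd n l := by
  simp only [zDd, zEd]
  split_ifs <;> simp [inclD]

@[simp] theorem inclD_single (n : ℤ) (b : DBs n) :
    inclD n (single b 1) = single (.inl b) 1 := by
  simp [inclD]

theorem single_inl_eq_wDd {n : ℤ} (k : WIdx n) : (single (.inl k) 1 : Dd n) = wDd n k := by
  rw [wDd, dif_pos k.2]

theorem single_inr_eq_zDd {n : ℤ} (l : ZIdx n) : (single (.inr l) 1 : Dd n) = zDd n l := by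
  rw [zDd, dif_pos l.2]

@[simp] theorem dDd_wDd (n k : ℤ) : dDd n (wDd n k) = 0 := by
  simp only [wDd]
  split_ifs <;> simp [dDd]

theorem dDd_zDd_zero {n : ℤ} (hn : 1 ≤ n) :
    dDd n (zDd n 0) = UU ^ n.toNat • wDd n (-1) + VV ^ n.toNat • wDd n 1 := by
  have h : (0 : ℤ) % 2 = 0 ∧ -(4*n - 2) ≤ 0 ∧ 0 ≤ 4*n - 2 := by omega
  have h₁ : (4*n + 3) / 4 = n := by omega
  rw [zDd, dif_pos h]
  simp [dDd, h₁]

theorem dEd_inclD (n : ℤ) (x : Dd n) : dEd n (inclD n x) = inclD n (dDd n x) := by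
  have : dEd n ∘ₗ inclD n = inclD n ∘ₗ dDd n := by
    ext1 b
    ext1
    rcases b with ⟨k, hk⟩ | ⟨l, hl⟩ <;> simp [dEd, dDd]
  exact LinearMap.congr_fun this x

@[simp] theorem dEd_sEd_r0 (n : ℤ) : dEd n (sEd n SB.r0) = 0 := by
  simp [dEd, sEd]

@[simp] theorem dEd_sEd_rm (n : ℤ) : dEd n (sEd n SB.rm) = VV ^ n.toNat • sEd n SB.r0 := by
  simp [dEd, sEd]

@[simp] theorem dEd_sEd_rp (n : ℤ) : dEd n (sEd n SB.rp) = UU ^ n.toNat • sEd n SB.r0 := by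
  simp [dEd, sEd]

@[simp] theorem dEd_sEd_t (n : ℤ) :
    dEd n (sEd n SB.t) = UU ^ n.toNat • sEd n SB.rm + VV ^ n.toNat • sEd n SB.rp := by
  simp [dEd, sEd]

@[simp] theorem dBd_v (n : ℤ) : dBd n (bBd BB.v) = 0 := by
  simp [dBd, bBd]

@[simp] theorem dBd_r0 (n : ℤ) : dBd n (bBd BB.r0) = 0 := by
  simp [dBd, bBd]

@[simp] theorem dBd_rm (n : ℤ) : dBd n (bBd BB.rm) = VV ^ n.toNat • bBd BB.r0 := by
  simp [dBd, bBd]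

@[simp] theorem dBd_rp (n : ℤ) : dBd n (bBd BB.rp) = UU ^ n.toNat • bBd BB.r0 := by
  simp [dBd, bBd]

@[simp] theorem dBd_t (n : ℤ) :
    dBd n (bBd BB.t) = UU ^ n.toNat • bBd BB.rm + VV ^ n.toNat • bBd BB.rp := by
  simp [dBd, bBd]

/-- The Leibniz rule. -/
theorem dDBd_tp (n : ℤ) (x : Dd n) (b : BB) :
    dDBd n (tp x (bBd b)) = tp (dDd n x) (bBd b) + tp x (dBd n (bBd b)) := by
  induction x using Finsupp.induction_linear with
  | zero => simp
  | add x y hx hy => simp only [map_add, tp_add_left, hx, hy]; abel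
  | single a c =>
    rw [← mul_one c, ← smul_eq_mul, ← Finsupp.smul_single]
    simp only [map_smul, tp_smul_left, ← smul_add]
    congr 1
    simp [dDBd, bBd]

/-! ### The map `g` -/

theorem gEDBd_inclD (n : ℤ) (x : Dd n) : gEDBd n (inclD n x) = tp x (bBd BB.v) := by
  induction x using Finsupp.induction_linear with
  | zero => simp
  | add x y hx hy => simp only [map_add, tp_add_left, hx, hy]
  | single a c =>
    rw [← mul_one c, ← smul_eq_mul, ← Finsupp.smul_single]
    simp only [map_smul, tp_smul_left]
    congr 1
    rcases a with ⟨k, hk⟩ | ⟨l, hl⟩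
    · rw [inclD_single, gEDBd, linearCombination_single, one_smul, single_inl_eq_wDd]
    · rw [inclD_single, gEDBd, linearCombination_single, one_smul, single_inr_eq_zDd]

@[simp] theorem gEDBd_wEd (n k : ℤ) : gEDBd n (wEd n k) = tp (wDd n k) (bBd BB.v) := by
  rw [← inclD_wDd, gEDBd_inclD]

@[simp] theorem gEDBd_zEd (n l : ℤ) : gEDBd n (zEd n l) = tp (zDd n l) (bBd BB.v) := by
  rw [← inclD_zDd, gEDBd_inclD]

@[simp] theorem gEDBd_r0 (n : ℤ) : gEDBd n (sEd n SB.r0) =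
    tp (zDd n 0) (bBd BB.r0) + tp (wDd n (-1)) (bBd BB.rp) + tp (wDd n 1) (bBd BB.rm) := by
  simp [gEDBd, sEd]

@[simp] theorem gEDBd_rm (n : ℤ) : gEDBd n (sEd n SB.rm) =
    tp (wDd n (-1)) (bBd BB.t) + tp (zDd n 0) (bBd BB.rm) := by
  simp [gEDBd, sEd]

@[simp] theorem gEDBd_rp (n : ℤ) : gEDBd n (sEd n SB.rp) =
    tp (wDd n 1) (bBd BB.t) + tp (zDd n 0) (bBd BB.rp) := by
  simp [gEDBd, sEd]

@[simp] theorem gEDBd_t (n : ℤ) : gEDBd n (sEd n SB.t) = tp (zDd n 0) (bBd BB.t) := by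
  simp [gEDBd, sEd]

theorem Ed_hom_ext {n : ℤ} {M : Type} [AddCommMonoid M] [Module R2 M] {φ ψ : Ed n →ₗ[R2] M}
    (hD : ∀ x, φ (inclD n x) = ψ (inclD n x)) (hS : ∀ s, φ (sEd n s) = ψ (sEd n s)) : φ = ψ := by
  ext1 b
  ext1
  rcases b with b | s
  · simpa using hD (single b 1)
  · exact hS s

theorem DBd_hom_ext {n : ℤ} {M : Type} [AddCommMonoid M] [Module R2 M] {φ ψ : DBd n →ₗ[R2] M}
    (h : ∀ x b, φ (tp x (bBd b)) = ψ (tp x (bBd b))) : φ = ψ := by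
  ext1 p
  ext1
  simpa [bBd] using h (single p.1 1) p.2

theorem gEDBd_dEd {n : ℤ} (hn : 1 ≤ n) (ξ : Ed n) : gEDBd n (dEd n ξ) = dDBd n (gEDBd n ξ) := by
  suffices gEDBd n ∘ₗ dEd n = dDBd n ∘ₗ gEDBd n from LinearMap.congr_fun this ξ
  refine Ed_hom_ext (fun x => ?_) fun s => ?_
  · simp [dEd_inclD, gEDBd_inclD, dDBd_tp]
  · have h2 (x : DBd n) := add_self_finsupp x
    cases s <;>
      simp only [LinearMap.comp_apply, dEd_sEd_r0, dEd_sEd_rm, dEd_sEd_rp, dEd_sEd_t, map_zero,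
        map_add, map_smul, gEDBd_r0, gEDBd_rm, gEDBd_rp, gEDBd_t, dDBd_tp, dDd_wDd,
        dDd_zDd_zero hn, dBd_r0, dBd_rm, dBd_rp, dBd_t, tp_add_left, tp_add_right,
        tp_smul_left, tp_smul_right, tp_zero_left, tp_zero_right, smul_add]
    · linear_combination (norm := module)
        -h2 (UU ^ n.toNat • tp (wDd n (-1)) (bBd BB.r0)) -
          h2 (VV ^ n.toNat • tp (wDd n 1) (bBd BB.r0))
    · linear_combination (norm := module) -h2 (UU ^ n.toNat • tp (wDd n (-1)) (bBd BB.rm))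
    · linear_combination (norm := module) -h2 (VV ^ n.toNat • tp (wDd n 1) (bBd BB.rp))
    · abel

/-! ### Equivariance -/

theorem ττDBd_tp_wDd (n k : ℤ) (b : BB) :
    ττDBd n (tp (wDd n k) (bBd b)) = tp (wDd n (-k)) (τBdb b) := by
  by_cases h : k % 2 = 1 ∧ -(4*n - 3) ≤ k ∧ k ≤ 4*n - 3
  · rw [wDd, dif_pos h, bBd, tp_single, one_mul, ττDBd, skewExt_single, τDdb]
  · have h' : ¬ (-k % 2 = 1 ∧ -(4*n - 3) ≤ -k ∧ -k ≤ 4*n - 3) := by omega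
    simp only [ττDBd, wDd, dif_neg h, dif_neg h', tp_zero_left, skewExt_zero]

theorem ττDBd_tp_zDd (n l : ℤ) (b : BB) :
    ττDBd n (tp (zDd n l) (bBd b)) = tp (zDd n (-l)) (τBdb b) := by
  by_cases h : l % 2 = 0 ∧ -(4*n - 2) ≤ l ∧ l ≤ 4*n - 2
  · rw [zDd, dif_pos h, bBd, tp_single, one_mul, ττDBd, skewExt_single, τDdb]
  · have h' : ¬ (-l % 2 = 0 ∧ -(4*n - 2) ≤ -l ∧ -l ≤ 4*n - 2) := by omega
    simp only [ττDBd, zDd, dif_neg h, dif_neg h', tp_zero_left, skewExt_zero]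

theorem gEDBd_τEd (n : ℤ) (ξ : Ed n) : gEDBd n (τEd n ξ) = ττDBd n (gEDBd n ξ) := by
  have hadd (x y : DBd n) : ττDBd n (x + y) = ττDBd n x + ττDBd n y := skewExt_add _ x y
  induction ξ using Finsupp.induction_linear with
  | zero => simp [τEd, ττDBd]
  | add x y hx hy =>
    rw [τEd, skewExt_add, map_add, map_add, hadd, ← hx, ← hy, τEd]
  | single b c =>
    rw [← mul_one c, ← smul_eq_mul, ← Finsupp.smul_single, map_smul, τEd, ττDBd, skewExt_smul,
      skewExt_smul, map_smul, skewExt_single, ← ττDBd]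
    congr 1
    rcases b with (k | l) | s
    · rw [← inclD_single, gEDBd_inclD, single_inl_eq_wDd, ττDBd_tp_wDd]
      simp [τBdb]
    · rw [← inclD_single, gEDBd_inclD, single_inr_eq_zDd, ττDBd_tp_zDd]
      simp [τBdb]
    · change _ = ττDBd n (gEDBd n (sEd n s))
      cases s <;>
        simp only [gEDBd_r0, gEDBd_rm, gEDBd_rp, gEDBd_t, hadd, map_add, ττDBd_tp_wDd,
          ττDBd_tp_zDd, τBdb, neg_neg, neg_zero, gEDBd_wEd, gEDBd_zEd, tp_add_right] <;>
        abel

/-! ### Gradings -/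

theorem Homog.add {β : Type} {g : β → ℤ × ℤ} {deg : ℤ × ℤ} {x y : β →₀ R2}
    (hx : Homog g deg x) (hy : Homog g deg y) : Homog g deg (x + y) := by
  intro b _ m hm
  have key : ((x b).coeff m) ≠ 0 ∨ ((y b).coeff m) ≠ 0 := by
    by_contra! h
    simp [h] at hm
  rcases key with h | h
  · exact hx b (by rw [Finsupp.mem_support_iff]; rintro h0; simp [h0] at h) m
      (MvPolynomial.mem_support_iff.2 h)
  · exact hy b (by rw [Finsupp.mem_support_iff]; rintro h0; simp [h0] at h) m
      (MvPolynomial.mem_support_iff.2 h)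

theorem homog_single {β : Type} {g : β → ℤ × ℤ} {deg : ℤ × ℤ} {b : β} (h : g b = deg) :
    Homog g deg (single b 1) := by
  classical
  intro b' hb m hm
  obtain rfl : b' = b := by
    by_contra hne
    exact hne (by simpa [Finsupp.single_apply, eq_comm] using hb)
  obtain rfl : m = 0 := by
    by_contra hne
    exact hne (by simpa [MvPolynomial.coeff_one, eq_comm] using hm)
  simp [h]

theorem homog_zero {β : Type} (g : β → ℤ × ℤ) (deg : ℤ × ℤ) : Homog g deg 0 := by
  intro b hb
  simp at hb

theorem homog_tp_wDd {n k : ℤ} {gw gz : ℤ → ℤ × ℤ} {gB : BB → ℤ × ℤ} {deg : ℤ × ℤ} {b : BB}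
    (h : -gw k + -gB b = deg) : Homog (grDBd gw gz gB) deg (tp (wDd n k) (bBd b)) := by
  rw [wDd, bBd]
  split_ifs with hk
  · rw [tp_single, one_mul]
    exact homog_single h
  · simpa using homog_zero _ _

theorem homog_tp_zDd {n l : ℤ} {gw gz : ℤ → ℤ × ℤ} {gB : BB → ℤ × ℤ} {deg : ℤ × ℤ} {b : BB}
    (h : -gz l + -gB b = deg) : Homog (grDBd gw gz gB) deg (tp (zDd n l) (bBd b)) := by
  rw [zDd, bBd]
  split_ifs with hl
  · rw [tp_single, one_mul]
    exact homog_single h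
  · simpa using homog_zero _ _

theorem homog_gEDBd {n : ℤ} (hn : 1 ≤ n) {gw gz : ℤ → ℤ × ℤ} {gS : SB → ℤ × ℤ} {gB : BB → ℤ × ℤ}
    (hD : IsDGrading n gw gz) (hS : IsSGrading n gz gS) (hB : IsBGrading n gB) (b : EB n) :
    Homog (grDBd gw gz gB) (-(grE gw gz gS b)) (gEDBd n (single b 1)) := by
  obtain ⟨-, -, hD⟩ := hD
  have hm := (hD (-1) (by omega) (by omega) (by omega)).2
  have hp := (hD 1 (by omega) (by omega) (by omega)).1
  norm_num [Prod.ext_iff] at hm hp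
  simp only [IsSGrading, IsBGrading, Prod.ext_iff] at hS hB
  rcases b with (k | l) | s
  · rw [← inclD_single, gEDBd_inclD, single_inl_eq_wDd]
    exact homog_tp_wDd (by ext <;> simp [grE, hB])
  · rw [← inclD_single, gEDBd_inclD, single_inr_eq_zDd]
    exact homog_tp_zDd (by ext <;> simp [grE, hB])
  · change Homog _ _ (gEDBd n (sEd n s))
    cases s
    · rw [gEDBd_r0]
      refine ((homog_tp_zDd ?_).add (homog_tp_wDd ?_)).add (homog_tp_wDd ?_) <;>
        ext <;> simp [grE] <;> omega
    · rw [gEDBd_rm]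
      refine (homog_tp_wDd ?_).add (homog_tp_zDd ?_) <;> ext <;> simp [grE] <;> omega
    · rw [gEDBd_rp]
      refine (homog_tp_wDd ?_).add (homog_tp_zDd ?_) <;> ext <;> simp [grE] <;> omega
    · rw [gEDBd_t]
      refine homog_tp_zDd ?_
      ext <;> simp [grE] <;> omega

/-! ### Contraction of the square summands after inverting `UV` -/

/-- The projection `D_n^∨ ⊗ B_n^∨ → D_n^∨ ⊗ v^∨ ≅ D_n^∨ ⊆ E_n^∨`. -/
noncomputable def projD (n : ℤ) : DBd n →ₗ[R2] Ed n :=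
  linearCombination R2 fun p => match p.2 with
  | BB.v => inclD n (single p.1 1)
  | _ => 0

/-- A homotopy on `E_n^∨` from `(UV)^n` times the projection onto `S_n^∨` to zero. -/
noncomputable def homotopyE (n : ℤ) : Ed n →ₗ[R2] Ed n :=
  linearCombination R2 fun b => match b with
  | .inr SB.r0 => UU ^ n.toNat • sEd n SB.rm
  | .inr SB.rp => UU ^ n.toNat • sEd n SB.t
  | _ => 0

/-- A homotopy on `D_n^∨ ⊗ B_n^∨` from `(UV)^n` times the projection onto `D_n^∨ ⊗ S_n^∨`
to zero. -/
noncomputable def homotopyDB (n : ℤ) : DBd n →ₗ[R2] DBd n :=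
  linearCombination R2 fun p => match p.2 with
  | BB.r0 => UU ^ n.toNat • tp (single p.1 1) (bBd BB.rm)
  | BB.rp => UU ^ n.toNat • tp (single p.1 1) (bBd BB.t)
  | _ => 0

theorem projD_tp (n : ℤ) (x : Dd n) (b : BB) : projD n (tp x (bBd b)) = match b with
    | BB.v => inclD n x
    | _ => 0 := by
  induction x using Finsupp.induction_linear with
  | zero => cases b <;> simp
  | add x y hx hy => rw [tp_add_left, map_add, hx, hy]; cases b <;> simp
  | single a c =>
    rw [← mul_one c, ← smul_eq_mul, ← Finsupp.smul_single, tp_smul_left, map_smul]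
    have key : projD n (tp (single a 1) (bBd b)) = match b with
        | BB.v => inclD n (single a 1)
        | _ => 0 := by
      cases b <;> simp [projD, bBd]
    rw [key]
    cases b <;> simp only [map_smul, smul_zero]

theorem homotopyDB_tp (n : ℤ) (x : Dd n) (b : BB) : homotopyDB n (tp x (bBd b)) = match b with
    | BB.r0 => UU ^ n.toNat • tp x (bBd BB.rm)
    | BB.rp => UU ^ n.toNat • tp x (bBd BB.t)
    | _ => 0 := by
  induction x using Finsupp.induction_linear with
  | zero => cases b <;> simp
  | add x y hx hy => rw [tp_add_left, map_add, hx, hy]; cases b <;> simp [tp_add_left]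
  | single a c =>
    rw [← mul_one c, ← smul_eq_mul, ← Finsupp.smul_single, tp_smul_left, map_smul]
    have key : homotopyDB n (tp (single a 1) (bBd b)) = match b with
        | BB.r0 => UU ^ n.toNat • tp (single a 1) (bBd BB.rm)
        | BB.rp => UU ^ n.toNat • tp (single a 1) (bBd BB.t)
        | _ => 0 := by
      cases b <;> simp [homotopyDB, bBd]
    rw [key]
    cases b <;> simp only [tp_smul_left, smul_zero, smul_comm c (UU ^ n.toNat)]

@[simp] theorem homotopyE_inclD (n : ℤ) (x : Dd n) : homotopyE n (inclD n x) = 0 := by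
  suffices homotopyE n ∘ₗ inclD n = 0 from LinearMap.congr_fun this x
  ext1 b
  ext1
  simp [homotopyE]

theorem homotopyE_sEd (n : ℤ) (s : SB) : homotopyE n (sEd n s) = match s with
    | SB.r0 => UU ^ n.toNat • sEd n SB.rm
    | SB.rp => UU ^ n.toNat • sEd n SB.t
    | _ => 0 := by
  cases s <;> simp [homotopyE, sEd]

theorem dEd_projD (n : ℤ) (c : DBd n) : dEd n (projD n c) = projD n (dDBd n c) := by
  suffices dEd n ∘ₗ projD n = projD n ∘ₗ dDBd n from LinearMap.congr_fun this c
  refine DBd_hom_ext fun x b => ?_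
  cases b <;> simp [dDBd_tp, projD_tp, dEd_inclD, tp_add_right, tp_smul_right]

theorem UV_pow_smul_DBd (n : ℤ) (c : DBd n) : (UU * VV) ^ n.toNat • c =
    (UU * VV) ^ n.toNat • gEDBd n (projD n c) + dDBd n (homotopyDB n c) +
      homotopyDB n (dDBd n c) := by
  suffices (UU * VV) ^ n.toNat • LinearMap.id =
      (UU * VV) ^ n.toNat • gEDBd n ∘ₗ projD n + dDBd n ∘ₗ homotopyDB n +
        homotopyDB n ∘ₗ dDBd n from LinearMap.congr_fun this c
  refine DBd_hom_ext fun x b => ?_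
  have h2 (x : DBd n) := add_self_finsupp x
  cases b <;>
    simp only [LinearMap.smul_apply, LinearMap.id_apply, LinearMap.add_apply,
      LinearMap.comp_apply, projD_tp, homotopyDB_tp, gEDBd_inclD, dDBd_tp, map_zero, map_add,
      map_smul, dBd_v, dBd_r0, dBd_rm, dBd_rp, dBd_t, tp_add_right, tp_smul_right, tp_zero_right,
      smul_add, smul_zero, mul_pow]
  · module
  · linear_combination (norm := module) -h2 (UU ^ n.toNat • tp (dDd n x) (bBd BB.rm))
  · module
  · linear_combination (norm := module) -h2 (UU ^ n.toNat • tp (dDd n x) (bBd BB.t)) -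
      h2 (UU ^ n.toNat • UU ^ n.toNat • tp x (bBd BB.rm))
  · module

theorem UV_pow_smul_Ed (n : ℤ) (a : Ed n) : (UU * VV) ^ n.toNat • a =
    (UU * VV) ^ n.toNat • projD n (gEDBd n a) + dEd n (homotopyE n a) +
      homotopyE n (dEd n a) := by
  suffices (UU * VV) ^ n.toNat • LinearMap.id =
      (UU * VV) ^ n.toNat • projD n ∘ₗ gEDBd n + dEd n ∘ₗ homotopyE n +
        homotopyE n ∘ₗ dEd n from LinearMap.congr_fun this a
  refine Ed_hom_ext (fun x => ?_) fun s => ?_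
  · simp [gEDBd_inclD, projD_tp, dEd_inclD]
  · have h2 (x : Ed n) := add_self_finsupp x
    cases s <;>
      simp only [LinearMap.smul_apply, LinearMap.id_apply, LinearMap.add_apply,
        LinearMap.comp_apply, projD_tp, homotopyE_sEd, gEDBd_r0, gEDBd_rm, gEDBd_rp, gEDBd_t,
        dEd_sEd_r0, dEd_sEd_rm, dEd_sEd_rp, dEd_sEd_t, map_zero, map_add, map_smul, smul_add,
        smul_zero, mul_pow]
    · module
    · module
    · linear_combination (norm := module) -h2 (UU ^ n.toNat • UU ^ n.toNat • sEd n SB.rm)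
    · module

/-- The map `g : E_n^∨ → D_n^∨ ⊗_R B_n^∨` is a grading-preserving
chain map satisfying `g ∘ τ_E^∨ = (τ_D^∨ ⊗ τ_B^∨) ∘ g`, and it induces an isomorphism
on homology after tensoring over `R` with `F₂[U^{±1}, V^{±1}]` (expressed below by
saying that on homology it becomes surjective and injective up to multiplication by
powers of `UV`). -/
theorem g_is_local_equivalence (n : ℤ) (hn : 1 ≤ n) :
    -- `g` is grading-preserving:
    (∀ gw gz gS gB, IsDGrading n gw gz → IsSGrading n gz gS → IsBGrading n gB →
      ∀ b : EB n, Homog (grDBd gw gz gB) (-(grE gw gz gS b)) (gEDBd n (single b 1))) ∧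
    -- `g` is a chain map:
    (∀ ξ : Ed n, gEDBd n (dEd n ξ) = dDBd n (gEDBd n ξ)) ∧
    -- `g ∘ τ_E^∨ = (τ_D^∨ ⊗ τ_B^∨) ∘ g`:
    (∀ ξ : Ed n, gEDBd n (τEd n ξ) = ττDBd n (gEDBd n ξ)) ∧
    -- `g` induces an isomorphism on homology after inverting `UV`:
    ((∀ c : DBd n, dDBd n c = 0 →
        ∃ (k : ℕ) (a : Ed n) (w : DBd n),
          dEd n a = 0 ∧ (UU * VV)^k • c = gEDBd n a + dDBd n w) ∧
     (∀ a : Ed n, dEd n a = 0 →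
        (∃ (k : ℕ) (w : DBd n), (UU * VV)^k • gEDBd n a = dDBd n w) →
        ∃ (k : ℕ) (v : Ed n), (UU * VV)^k • a = dEd n v)) := by
  refine ⟨fun _ _ _ _ hD hS hB b => homog_gEDBd hn hD hS hB b, gEDBd_dEd hn, gEDBd_τEd n,
    fun c hc => ?_, fun a ha ⟨k, w, hw⟩ => ?_⟩
  · refine ⟨n.toNat, (UU * VV) ^ n.toNat • projD n c, homotopyDB n c, ?_, ?_⟩
    · rw [map_smul, dEd_projD, hc, map_zero, smul_zero]
    · rw [UV_pow_smul_DBd, hc, map_zero, add_zero, map_smul]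
  · refine ⟨k + n.toNat, (UU * VV) ^ n.toNat • projD n w + (UU * VV) ^ k • homotopyE n a, ?_⟩
    rw [pow_add, mul_smul, UV_pow_smul_Ed, ha, map_zero, add_zero, smul_add,
      smul_comm, ← map_smul (projD n), hw, ← dEd_projD, map_add, map_smul, map_smul]
end

section
/- Fix an integer n ≥ 1 and let X be the chain complex of free F₂[T]-modules with basis elements v and t in degree 0, r₀ in degree −2n+2, and α and β in degree −2n+1, with differential ∂v = ∂t = 0, ∂r₀ = α + β, ∂α = ∂β = Tⁿ t, equipped with the grading-preserving T-equivariant chain involution τ given by τ(v) = v + t, τ(t) = t, τ(r₀) = r₀, τ(α) = β, τ(β) = α. Then d̲_τ(X) = −2n and d̄_τ(X) = 0. (Here X is the Alexander-grading-zero subcomplex of the box complex B_n with its induced involution, and this computation proves that V̲₀^τ of the knots K_n is at least n.) -/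
open Finsupp Polynomial

/-- The coefficient ring `F₂[T]`; `T` has degree `−2`. -/
abbrev PT : Type := Polynomial F2

/-- The basis of the complex `X` (the Alexander-grading-zero subcomplex of the box
complex `B_n`): `v` and `t` in degree `0`, `r₀` in degree `−2n+2`, and `α`, `β` in
degree `−2n+1`. -/
inductive XB : Type | v : XB | t : XB | r0 : XB | α : XB | β : XB

/-- The underlying module of `X`, free over `F₂[T]` on the basis `XB`. -/
abbrev Xc : Type := XB →₀ PT

/-- The degrees of the basis elements of `X`. -/
def degX (n : ℤ) : XB → ℤ
  | XB.v => 0 | XB.t => 0 | XB.r0 => -2*n + 2 | XB.α => -2*n + 1 | XB.β => -2*n + 1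

/-- `x` is homogeneous of degree `r` (the variable `T` has degree `−2`). -/
def HomogX (n : ℤ) (r : ℤ) (x : Xc) : Prop :=
  ∀ b ∈ x.support, ∀ i : ℕ, (x b).coeff i ≠ 0 → degX n b - 2 * (i : ℤ) = r

/-- The differential of `X`: `∂v = ∂t = 0`, `∂r₀ = α + β`, `∂α = ∂β = Tⁿ t`. -/
noncomputable def dX (n : ℕ) : Xc →ₗ[PT] Xc :=
  linearCombination PT fun b => match b with
  | XB.v => 0
  | XB.t => 0
  | XB.r0 => single XB.α 1 + single XB.β 1
  | XB.α => (Polynomial.X ^ n : PT) • single XB.t 1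
  | XB.β => (Polynomial.X ^ n : PT) • single XB.t 1

/-- The involution `τ` of `X`: `τ(v) = v + t`, `τ(t) = t`, `τ(r₀) = r₀`, `τ(α) = β`,
`τ(β) = α`.  It is `T`-equivariant and grading-preserving. -/
noncomputable def τX : Xc →ₗ[PT] Xc :=
  linearCombination PT fun b => match b with
  | XB.v => single XB.v 1 + single XB.t 1
  | XB.t => single XB.t 1
  | XB.r0 => single XB.r0 1
  | XB.α => single XB.β 1
  | XB.β => single XB.α 1

/-- The mapping cone `CFI^τ(X)` of `Q·(1 + τ) : X → Q·X`, realized as `X × X` where the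
second factor is the copy `Q·X` (with grading shifted down by `1`). -/
abbrev Cone : Type := Xc × Xc

/-- The differential of the mapping cone: `D(x, Qy) = (∂x, Q((1+τ)x) + Q(∂y))`. -/
noncomputable def Dcone (n : ℕ) : Cone →ₗ[PT] Cone :=
  LinearMap.prod (dX n ∘ₗ LinearMap.fst PT Xc Xc)
    (LinearMap.fst PT Xc Xc + τX ∘ₗ LinearMap.fst PT Xc Xc + dX n ∘ₗ LinearMap.snd PT Xc Xc)

/-- Multiplication by the formal variable `Q` (of degree `−1`) on the cone:
`Q·(x, Qy) = (0, Qx)`. -/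
noncomputable def Qmap : Cone →ₗ[PT] Cone :=
  LinearMap.prod 0 (LinearMap.fst PT Xc Xc)

/-- An element `(x, Qy)` of the cone is homogeneous of degree `r` iff `x` is homogeneous
of degree `r` and `y` is homogeneous of degree `r + 1`. -/
def HomogCone (n : ℤ) (r : ℤ) (c : Cone) : Prop :=
  HomogX n r c.1 ∧ HomogX n (r + 1) c.2

/-- "There is a homology class of `CFI^τ(X)` of grading `r` with `Tᵐ·x ≠ 0` and
`Tᵐ·x ∉ im(Q)` for all `m ≥ 0`" — the defining condition for `d̲_τ`. -/
def LowerCond (n : ℕ) (r : ℤ) : Prop :=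
  ∃ c : Cone, Dcone n c = 0 ∧ HomogCone n r c ∧
    ∀ m : ℕ,
      (¬ ∃ w : Cone, Dcone n w = (Polynomial.X ^ m : PT) • c) ∧
      (¬ ∃ z w : Cone, Dcone n z = 0 ∧ (Polynomial.X ^ m : PT) • c = Qmap z + Dcone n w)

/-- "There is a homology class of `CFI^τ(X)` of grading `r` with `Tᵐ·x ≠ 0` for all
`m ≥ 0` and `Tᵐ·x ∈ im(Q)` for some `m`" — the defining condition for `d̄_τ` (which is
`1` plus the maximal such `r`). -/
def UpperCond (n : ℕ) (r : ℤ) : Prop :=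
  ∃ c : Cone, Dcone n c = 0 ∧ HomogCone n r c ∧
    (∀ m : ℕ, ¬ ∃ w : Cone, Dcone n w = (Polynomial.X ^ m : PT) • c) ∧
    (∃ (m : ℕ) (z w : Cone), Dcone n z = 0 ∧
      (Polynomial.X ^ m : PT) • c = Qmap z + Dcone n w)

/-- The element of `X` with the given coordinates in the basis `v, t, r₀, α, β`. -/
noncomputable def ofCoords (v t r a b : PT) : Xc :=
  single XB.v v + single XB.t t + single XB.r0 r + single XB.α a + single XB.β b

@[simp] lemma ofCoords_v (v t r a b : PT) : ofCoords v t r a b XB.v = v := by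
  simp [ofCoords]
@[simp] lemma ofCoords_t (v t r a b : PT) : ofCoords v t r a b XB.t = t := by
  simp [ofCoords]
@[simp] lemma ofCoords_r0 (v t r a b : PT) : ofCoords v t r a b XB.r0 = r := by
  simp [ofCoords]
@[simp] lemma ofCoords_α (v t r a b : PT) : ofCoords v t r a b XB.α = a := by
  simp [ofCoords]
@[simp] lemma ofCoords_β (v t r a b : PT) : ofCoords v t r a b XB.β = b := by
  simp [ofCoords]

lemma Xc_ext_iff (x y : Xc) : x = y ↔ x XB.v = y XB.v ∧ x XB.t = y XB.t ∧
    x XB.r0 = y XB.r0 ∧ x XB.α = y XB.α ∧ x XB.β = y XB.β := by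
  refine ⟨by rintro rfl; simp, fun ⟨h1, h2, h3, h4, h5⟩ => Finsupp.ext fun b => ?_⟩
  cases b <;> assumption

lemma eq_ofCoords (x : Xc) : x = ofCoords (x XB.v) (x XB.t) (x XB.r0) (x XB.α) (x XB.β) := by
  simp [Xc_ext_iff]

lemma dX_eq (n : ℕ) (x : Xc) :
    dX n x = ofCoords 0 (Polynomial.X ^ n * (x XB.α + x XB.β)) 0 (x XB.r0) (x XB.r0) := by
  conv_lhs => rw [eq_ofCoords x]
  simp [Xc_ext_iff, dX, ofCoords, mul_comm, mul_add]

lemma τX_eq (x : Xc) :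
    τX x = ofCoords (x XB.v) (x XB.v + x XB.t) (x XB.r0) (x XB.β) (x XB.α) := by
  conv_lhs => rw [eq_ofCoords x]
  simp [Xc_ext_iff, τX, ofCoords]

lemma Dcone_eq_iff (n : ℕ) (w c : Cone) : Dcone n w = c ↔
    c.1 = ofCoords 0 (Polynomial.X ^ n * (w.1 XB.α + w.1 XB.β)) 0 (w.1 XB.r0) (w.1 XB.r0) ∧
    c.2 = ofCoords 0 (w.1 XB.v + Polynomial.X ^ n * (w.2 XB.α + w.2 XB.β)) 0
      (w.1 XB.α + w.1 XB.β + w.2 XB.r0) (w.1 XB.α + w.1 XB.β + w.2 XB.r0) := by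
  have h (p : PT) : p + p = 0 := CharTwo.add_self_eq_zero p
  have h2 : w.1 + τX w.1 + dX n w.2 =
      ofCoords 0 (w.1 XB.v + Polynomial.X ^ n * (w.2 XB.α + w.2 XB.β)) 0
      (w.1 XB.α + w.1 XB.β + w.2 XB.r0) (w.1 XB.α + w.1 XB.β + w.2 XB.r0) := by
    simp only [Xc_ext_iff, dX_eq, τX_eq, Finsupp.add_apply, ofCoords_v, ofCoords_t, ofCoords_r0,
      ofCoords_α, ofCoords_β]
    refine ⟨?_, ?_, ?_, ?_, ?_⟩ <;> grind
  rw [← h2, ← dX_eq, Prod.ext_iff]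
  simp [Dcone, eq_comm]

lemma X_pow_mul_eq_zero {m : ℕ} {p : PT} (h : Polynomial.X ^ m * p = 0) : p = 0 := by
  simpa using h

lemma Dcone_eq_zero_iff (n : ℕ) (c : Cone) : Dcone n c = 0 ↔
    c.1 XB.r0 = 0 ∧ c.1 XB.α = c.1 XB.β ∧ c.2 XB.r0 = 0 ∧
    c.1 XB.v = Polynomial.X ^ n * (c.2 XB.α + c.2 XB.β) := by
  have h (p : PT) : p + p = 0 := CharTwo.add_self_eq_zero p
  simp only [Dcone_eq_iff, Xc_ext_iff, ofCoords_v, ofCoords_t, ofCoords_r0, ofCoords_α, ofCoords_β,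
    Prod.fst_zero, Prod.snd_zero, Finsupp.zero_apply]
  have e (p q : PT) : 0 = p + q ↔ p = q := by rw [eq_comm]; exact CharTwo.add_eq_zero
  constructor
  · rintro ⟨⟨-, h1, -, h2, -⟩, -, h3, -, h4, -⟩
    have h5 : c.1 XB.α = c.1 XB.β := CharTwo.add_eq_zero.1 (X_pow_mul_eq_zero h1.symm)
    rw [h5, h, zero_add] at h4
    exact ⟨h2.symm, h5, h4.symm, (e _ _).1 h3⟩
  · rintro ⟨h1, h2, h3, h4⟩
    simp [h1, h2, h3, h4, h]

lemma X_pow_smul_eq_Qmap_add_Dcone {n : ℕ} {c : Cone} (hc : Dcone n c = 0)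
    (hv : c.1 XB.v = 0) :
    ∃ z w : Cone, Dcone n z = 0 ∧ (Polynomial.X ^ n : PT) • c = Qmap z + Dcone n w := by
  rw [Dcone_eq_zero_iff] at hc
  obtain ⟨h1, h2, h3, h4⟩ := hc
  have h5 : c.2 XB.α = c.2 XB.β :=
    CharTwo.add_eq_zero.1 (X_pow_mul_eq_zero (h4.symm.trans hv))
  refine ⟨((Polynomial.X ^ n : PT) • c.2 + ofCoords 0 0 0 (c.1 XB.t) (c.1 XB.t),
      ofCoords 0 0 0 (c.2 XB.v) 0),
    (ofCoords 0 0 (Polynomial.X ^ n * c.1 XB.α) (c.1 XB.t) 0, 0), ?_, ?_⟩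
  · simp [Dcone_eq_zero_iff, h3, h5]
  · rw [← sub_eq_iff_eq_add', eq_comm, Dcone_eq_iff]
    simp [Xc_ext_iff, Qmap, h1, ← h2, hv, CharTwo.neg_eq (c.1 XB.t)]

lemma X_pow_smul_eq_Dcone {n : ℕ} {c : Cone} (hc : Dcone n c = 0)
    (hv : c.1 XB.v = 0) (hv' : c.2 XB.v = 0) :
    ∃ w : Cone, Dcone n w = (Polynomial.X ^ n : PT) • c := by
  rw [Dcone_eq_zero_iff] at hc
  obtain ⟨h1, h2, h3, h4⟩ := hc
  have h5 : c.2 XB.α = c.2 XB.β :=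
    CharTwo.add_eq_zero.1 (X_pow_mul_eq_zero (h4.symm.trans hv))
  refine ⟨(ofCoords (Polynomial.X ^ n * c.2 XB.t) 0 (Polynomial.X ^ n * c.1 XB.α) (c.1 XB.t) 0,
    ofCoords 0 0 (Polynomial.X ^ n * c.2 XB.α + c.1 XB.t) 0 0), ?_⟩
  rw [Dcone_eq_iff]
  have h (p q : PT) : p = q + (p + q) := by
    rw [add_left_comm, CharTwo.add_self_eq_zero, add_zero]
  simp [Xc_ext_iff, h1, ← h2, h3, hv, hv', ← h5, ← h]

lemma HomogX.exists_coeff_ne_zero {n r : ℤ} {x : Xc} (hx : HomogX n r x) {b : XB} (hb : x b ≠ 0) :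
    ∃ i : ℕ, (x b).coeff i ≠ 0 ∧ degX n b - 2 * (i : ℤ) = r := by
  have hi := Polynomial.leadingCoeff_ne_zero.2 hb
  exact ⟨_, hi, hx b (by simpa using hb) _ hi⟩

lemma homogX_single {n r : ℤ} {b : XB} {i : ℕ} (h : degX n b - 2 * (i : ℤ) = r) :
    HomogX n r (single b (Polynomial.X ^ i)) := by
  classical
  intro b' hb' j hj
  rw [single_apply] at hj
  split_ifs at hj with hb
  · subst hb
    rw [Polynomial.coeff_X_pow] at hj
    grind
  · simp at hj

lemma fst_v_eq_zero_of_eq_Qmap_add_Dcone {n m : ℕ} {c z w : Cone}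
    (h : (Polynomial.X ^ m : PT) • c = Qmap z + Dcone n w) : c.1 XB.v = 0 := by
  have h1 : (Polynomial.X ^ m : PT) * c.1 XB.v = (Dcone n w).1 XB.v := by
    simpa [Qmap] using congrArg (fun d : Cone => d.1 XB.v) h
  rw [((Dcone_eq_iff n w _).1 rfl).1, ofCoords_v] at h1
  exact X_pow_mul_eq_zero h1

lemma v_eq_zero_of_Dcone_eq {n m : ℕ} {c w : Cone}
    (h : Dcone n w = (Polynomial.X ^ m : PT) • c) : c.1 XB.v = 0 ∧ c.2 XB.v = 0 := by
  obtain ⟨h1, h2⟩ := (Dcone_eq_iff n w _).1 h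
  rw [Xc_ext_iff] at h1 h2
  exact ⟨X_pow_mul_eq_zero (m := m) (by simpa using h1.1),
    X_pow_mul_eq_zero (m := m) (by simpa using h2.1)⟩

lemma lowerCond_neg_two_mul (n : ℕ) : LowerCond n (-2*n) := by
  refine ⟨(single XB.v (Polynomial.X ^ n), single XB.α (Polynomial.X ^ 0)), ?_,
    ⟨homogX_single (by simp [degX]), homogX_single (by simp [degX])⟩, fun m => ⟨?_, ?_⟩⟩
  · simp [Dcone_eq_zero_iff]
  · rintro ⟨w, hw⟩
    simpa using (v_eq_zero_of_Dcone_eq hw).1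
  · rintro ⟨z, w, -, hw⟩
    simpa using fst_v_eq_zero_of_eq_Qmap_add_Dcone hw

lemma LowerCond.le {n : ℕ} {r : ℤ} (h : LowerCond n r) : r ≤ -2*n := by
  obtain ⟨c, hc, hr, h⟩ := h
  have hv : c.1 XB.v ≠ 0 := fun hv => (h n).2 (X_pow_smul_eq_Qmap_add_Dcone hc hv)
  obtain ⟨i, hi, hir⟩ := hr.1.exists_coeff_ne_zero hv
  rw [((Dcone_eq_zero_iff n c).1 hc).2.2.2, Polynomial.coeff_X_pow_mul'] at hi
  simp only [degX] at hir
  grind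

lemma upperCond_neg_one (n : ℕ) : UpperCond n (0 - 1) := by
  have hc : Dcone n (0, single XB.v (Polynomial.X ^ 0)) = 0 := by
    simp [Dcone_eq_zero_iff]
  refine ⟨_, hc, ⟨by simp [HomogX], homogX_single (by simp [degX])⟩, ?_,
    n, X_pow_smul_eq_Qmap_add_Dcone hc rfl⟩
  rintro m ⟨w, hw⟩
  simpa using (v_eq_zero_of_Dcone_eq hw).2

lemma UpperCond.le {n : ℕ} {r : ℤ} (h : UpperCond n r) : r ≤ 0 - 1 := by
  obtain ⟨c, hc, hr, h, m, z, w, -, hw⟩ := h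
  have hv : c.2 XB.v ≠ 0 := fun hv =>
    h n (X_pow_smul_eq_Dcone hc (fst_v_eq_zero_of_eq_Qmap_add_Dcone hw) hv)
  obtain ⟨i, -, hir⟩ := hr.2.exists_coeff_ne_zero hv
  simp only [degX] at hir
  lia

/-- For the complex `X` (with the involution `τ`) above,
`d̲_τ(X) = −2n` and `d̄_τ(X) = 0`; that is, the defining condition for `d̲_τ` holds at
grading `−2n` and at no larger grading, and the condition for `d̄_τ` holds at grading
`−1 = 0 − 1` and at no larger grading. -/
theorem box_complex_d_invariants (n : ℕ) (hn : 1 ≤ n) :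
    (LowerCond n (-2*n) ∧ ∀ r : ℤ, LowerCond n r → r ≤ -2*n) ∧
    (UpperCond n (0 - 1) ∧ ∀ r : ℤ, UpperCond n r → r ≤ 0 - 1) := by
  exact ⟨⟨lowerCond_neg_two_mul n, fun _ h => h.le⟩, upperCond_neg_one n, fun _ h => h.le⟩
end
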